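/- Let X be a random variable with CDF F, and let 1 ≤ j ≤ m and 1 ≤ i ≤ n with i ≥ j. If F is IHR (i.e. x ↦ −log(1−F(x)) is convex on {x : F(x) < 1}) and ∑_{k=n−i+1}^{n} 1/k ≥ ∑_{k=m−j+1}^{m} 1/k, then X_{i:n} ≥_icv X_{j:m}. -/

import Mathlib

open MeasureTheory Set Filter

/-- Generalized inverse (quantile function) `F⁻¹(p) = inf {x | p ≤ F x}` of a CDF `F`. -/
noncomputable def qf (F : ℝ → ℝ) (p : ℝ) : ℝ := sInf {x | p ≤ F x}

/-- `F` is a cumulative distribution function: monotone, right-continuous, with limits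
`0` at `-∞` and `1` at `+∞`. -/
def IsCDF (F : ℝ → ℝ) : Prop :=
  Monotone F ∧ (∀ x, ContinuousWithinAt F (Set.Ici x) x) ∧
    Tendsto F atBot (nhds 0) ∧ Tendsto F atTop (nhds 1)

/-- The (real) Beta function `B(a,b) = ∫₀¹ t^(a-1) (1-t)^(b-1) dt`. -/
noncomputable def Bfun (a b : ℝ) : ℝ :=
  ∫ t in Set.Ioo (0:ℝ) 1, t ^ (a - 1) * (1 - t) ^ (b - 1)

/-- The Beta(i, n-i+1) distribution on `ℝ`, i.e. the law of the `i`-th order statistic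
`B_{i:n}` of an i.i.d. uniform sample of size `n`. -/
noncomputable def betaLaw (i n : ℕ) : Measure ℝ :=
  (volume.restrict (Set.Ioo (0:ℝ) 1)).withDensity fun t =>
    ENNReal.ofReal (t ^ ((i:ℝ) - 1) * (1 - t) ^ ((n:ℝ) - (i:ℝ)) / Bfun (i:ℝ) ((n:ℝ) - (i:ℝ) + 1))

/-- The law of the `i`-th order statistic `X_{i:n}` of an i.i.d. sample of size `n` from the
CDF `F`: the pushforward of the Beta(i, n-i+1) measure under the quantile function `F⁻¹`. -/
noncomputable def osLaw (F : ℝ → ℝ) (i n : ℕ) : Measure ℝ := (betaLaw i n).map (qf F)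

/-- The `k`-th harmonic number `H_k = ∑_{r=1}^k 1/r`. -/
noncomputable def harm (k : ℕ) : ℝ := ∑ r ∈ Finset.Icc 1 k, (1:ℝ) / r

/-- Increasing concave order: `icvLE μ ν` means a random variable with law `μ` dominates one
with law `ν` in the increasing concave order, i.e. `E u(X) ≥ E u(Y)` for every increasing
concave `u` for which both expectations exist. -/
def icvLE (μ ν : MeasureTheory.Measure ℝ) : Prop :=
  ∀ u : ℝ → ℝ, Monotone u → ConcaveOn ℝ Set.univ u →
    MeasureTheory.Integrable u μ → MeasureTheory.Integrable u ν →
      ∫ x, u x ∂ν ≤ ∫ x, u x ∂μ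

/-- Increasing convex order: `icxLE μ ν` means a random variable with law `μ` dominates one
with law `ν` in the increasing convex order, i.e. `E u(X) ≥ E u(Y)` for every increasing
convex `u` for which both expectations exist. -/
def icxLE (μ ν : MeasureTheory.Measure ℝ) : Prop :=
  ∀ u : ℝ → ℝ, Monotone u → ConvexOn ℝ Set.univ u →
    MeasureTheory.Integrable u μ → MeasureTheory.Integrable u ν →
      ∫ x, u x ∂ν ≤ ∫ x, u x ∂μ

/-- A star-shaped function on `[0,∞)`: nonnegative there, vanishing at `0`, with
`x ↦ φ x / x` increasing on `(0,∞)`. -/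
def StarShaped (φ : ℝ → ℝ) : Prop :=
  φ 0 = 0 ∧ (∀ x, 0 ≤ x → 0 ≤ φ x) ∧ MonotoneOn (fun x => φ x / x) (Set.Ioi 0)

/-- Star-shaped order: `ssLE μ ν` means a (nonnegative) random variable with law `μ`
dominates one with law `ν` in the star-shaped order, i.e. `E φ(X) ≥ E φ(Y)` for every
star-shaped `φ` for which both expectations exist. -/
def ssLE (μ ν : MeasureTheory.Measure ℝ) : Prop :=
  ∀ φ : ℝ → ℝ, StarShaped φ → MeasureTheory.Integrable φ μ → MeasureTheory.Integrable φ ν →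
    ∫ x, φ x ∂ν ≤ ∫ x, φ x ∂μ

/-- Unnormalised beta kernel with natural exponents. -/
noncomputable def bker (a b : ℕ) (t : ℝ) : ℝ := t ^ a * (1 - t) ^ b

/-- Beta integral with natural exponents. -/
noncomputable def bint (a b : ℕ) : ℝ := ∫ t in Ioo (0:ℝ) 1, bker a b t

/-- Log-moment of the beta kernel. -/
noncomputable def blog (a b : ℕ) : ℝ := ∫ t in Ioo (0:ℝ) 1, -Real.log (1 - t) * bker a b t

lemma bker_cont (a b : ℕ) : Continuous (bker a b) := by
  unfold bker; fun_prop

lemma bker_pos (a b : ℕ) {t : ℝ} (ht : t ∈ Ioo (0:ℝ) 1) : 0 < bker a b t := by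
  have h1 := ht.1
  have h2 : 0 < 1 - t := by linarith [ht.2]
  unfold bker; positivity

lemma bker_split (a b : ℕ) (t : ℝ) : bker (a+1) b t = bker a b t - bker a (b+1) t := by
  unfold bker; ring

lemma bker_int (a b : ℕ) : IntegrableOn (bker a b) (Ioo (0:ℝ) 1) := by
  rw [← intervalIntegrable_iff_integrableOn_Ioo_of_le zero_le_one]
  exact (bker_cont a b).intervalIntegrable _ _

lemma log1_int : IntervalIntegrable (fun t : ℝ => -Real.log (1 - t)) volume 0 1 := by
  have h := (intervalIntegral.intervalIntegrable_log' (a := 1) (b := 0)).comp_sub_left 1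
  have h2 := h.neg
  rw [sub_self, sub_zero] at h2
  exact h2

lemma blog_int (a b : ℕ) :
    IntegrableOn (fun t => -Real.log (1 - t) * bker a b t) (Ioo (0:ℝ) 1) := by
  rw [← intervalIntegrable_iff_integrableOn_Ioo_of_le zero_le_one]
  exact log1_int.mul_continuousOn (bker_cont a b).continuousOn

lemma Ioo_eq (f : ℝ → ℝ) : ∫ t in Ioo (0:ℝ) 1, f t = ∫ t in (0:ℝ)..1, f t := by
  rw [intervalIntegral.integral_of_le zero_le_one, integral_Ioc_eq_integral_Ioo]

lemma bint_zero (b : ℕ) : bint 0 b = 1 / (b + 1) := by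
  unfold bint
  rw [Ioo_eq]
  have h := intervalIntegral.integral_comp_sub_left (a := 0) (b := 1) (fun s : ℝ => s ^ b) 1
  simp only [bker, pow_zero, one_mul]
  rw [h]
  simp

lemma blog_zero (b : ℕ) : blog 0 b = 1 / ((b:ℝ) + 1) ^ 2 := by
  unfold blog
  rw [Ioo_eq]
  have h := intervalIntegral.integral_comp_sub_left (a := 0) (b := 1)
    (fun s : ℝ => -Real.log s * s ^ b) 1
  simp only [bker, pow_zero, one_mul]
  rw [h]
  have hb : (b:ℝ) + 1 ≠ 0 := by positivity
  have key := intervalIntegral.integral_eq_sub_of_hasDerivAt_of_le (a := 0) (b := 1)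
    (f := fun s : ℝ => -(s ^ b * (s * Real.log s)) / (b + 1) + s ^ (b + 1) / ((b:ℝ) + 1) ^ 2)
    (f' := fun s : ℝ => -Real.log s * s ^ b) zero_le_one ?_ ?_ ?_
  · simp only [sub_self, sub_zero]
    rw [key]
    simp
  · have := Real.continuous_mul_log
    apply Continuous.continuousOn
    apply Continuous.add
    · exact (((continuous_pow b).mul this).neg).div_const _
    · fun_prop
  · intro s hs
    have hs0 : s ≠ 0 := hs.1.ne'
    have h1 : HasDerivAt (fun s : ℝ => s ^ (b+1)) (((b:ℝ)+1) * s ^ b) s := by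
      simpa using hasDerivAt_pow (b+1) s
    have h2 := h1.mul (Real.hasDerivAt_log hs0)
    have h3 := (h2.neg.div_const ((b:ℝ)+1)).add (h1.div_const (((b:ℝ)+1)^2))
    convert! h3 using 1
    · ext x; simp [pow_succ]; ring
    · simp only [pow_succ]; field_simp; ring
  · exact (intervalIntegral.intervalIntegrable_log'.neg).mul_continuousOn
      (continuous_pow b).continuousOn

lemma bint_succ (a b : ℕ) : bint (a+1) b = bint a b - bint a (b+1) := by
  unfold bint
  rw [← integral_sub (bker_int a b) (bker_int a (b+1))]
  simp only [bker_split]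

lemma blog_succ (a b : ℕ) : blog (a+1) b = blog a b - blog a (b+1) := by
  unfold blog
  rw [← integral_sub (blog_int a b) (blog_int a (b+1))]
  simp only [bker_split, mul_sub]

lemma bint_rel (a b : ℕ) : bint a (b+1) = bint a b * ((b:ℝ)+1) / (a + b + 2) := by
  induction a generalizing b with
  | zero =>
    rw [bint_zero, bint_zero]; push_cast
    field_simp; ring
  | succ a ih =>
    rw [bint_succ, bint_succ, ih (b+1), ih b]; push_cast
    field_simp; ring

lemma blog_eq (a b : ℕ) : blog a b = bint a b * ∑ k ∈ Finset.Icc (b + 1) (a + b + 1), (1:ℝ) / k := by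
  induction a generalizing b with
  | zero =>
    rw [blog_zero, bint_zero]; simp; field_simp
  | succ a ih =>
    rw [blog_succ, ih, ih, bint_succ]
    have e1 : ∑ k ∈ Finset.Icc (b + 1) (a + 1 + b + 1), (1:ℝ) / k
        = ∑ k ∈ Finset.Icc (b + 1) (a + b + 1), (1:ℝ) / k + 1 / ((a:ℝ) + b + 2) := by
      rw [show a + 1 + b + 1 = (a + b + 1) + 1 by ring, Finset.sum_Icc_succ_top (by omega)]
      push_cast; ring_nf
    have e2 : ∑ k ∈ Finset.Icc (b + 1) (a + 1 + b + 1), (1:ℝ) / k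
        = 1 / ((b:ℝ) + 1) + ∑ k ∈ Finset.Icc (b + 1 + 1) (a + (b + 1) + 1), (1:ℝ) / k := by
      rw [show a + 1 + b + 1 = a + (b + 1) + 1 by ring,
        ← Finset.add_sum_Ioc_eq_sum_Icc (a := b + 1) (by omega)]
      push_cast
      congr 1
      apply Finset.sum_congr _ (fun _ _ => rfl)
      ext x; simp only [Finset.mem_Ioc, Finset.mem_Icc]; omega
    set S := ∑ k ∈ Finset.Icc (b + 1) (a + 1 + b + 1), (1:ℝ) / k
    have e1' := eq_sub_of_add_eq e1.symm
    have e2' := eq_sub_of_add_eq' e2.symm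
    rw [e1', e2', bint_rel]
    have : (a:ℝ) + b + 2 ≠ 0 := by positivity
    field_simp
    ring

lemma bint_pos (a b : ℕ) : 0 < bint a b := by
  unfold bint
  rw [Ioo_eq]
  apply intervalIntegral.intervalIntegral_pos_of_pos_on ((bker_cont a b).intervalIntegrable _ _)
  · intro x hx; exact bker_pos a b hx
  · exact zero_lt_one

/-- Beta density -/
noncomputable def bden (a b : ℕ) (t : ℝ) : ℝ := bker a b t / bint a b

lemma bden_pos (a b : ℕ) {t : ℝ} (ht : t ∈ Ioo (0:ℝ) 1) : 0 < bden a b t :=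
  div_pos (bker_pos a b ht) (bint_pos a b)

lemma bden_int (a b : ℕ) : IntegrableOn (bden a b) (Ioo (0:ℝ) 1) := (bker_int a b).div_const _

lemma bden_one (a b : ℕ) : ∫ t in Ioo (0:ℝ) 1, bden a b t = 1 := by
  unfold bden
  rw [integral_div]
  exact div_self (bint_pos a b).ne'

lemma bden_aff_int (a b : ℕ) (α β : ℝ) :
    IntegrableOn (fun t => (α + β * -Real.log (1 - t)) * bden a b t) (Ioo (0:ℝ) 1) := by
  have h := ((bden_int a b).const_mul α).add (((blog_int a b).div_const (bint a b)).const_mul β)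
  apply h.congr
  filter_upwards with t
  simp [bden]; ring

lemma bden_aff (a b : ℕ) (α β : ℝ) :
    ∫ t in Ioo (0:ℝ) 1, (α + β * -Real.log (1 - t)) * bden a b t
      = α + β * ∑ k ∈ Finset.Icc (b + 1) (a + b + 1), (1:ℝ) / k := by
  have h := integral_add ((bden_int a b).const_mul α)
    (((blog_int a b).div_const (bint a b)).const_mul β)
  rw [integral_const_mul, integral_const_mul, bden_one, integral_div] at h
  have e : (∫ t in Ioo (0:ℝ) 1, -Real.log (1 - t) * bker a b t) = blog a b := rfl
  rw [e, blog_eq, mul_div_cancel_left₀ _ (bint_pos a b).ne', mul_one] at h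
  rw [← h]
  congr 1
  ext t
  simp [bden]; ring

lemma betaLaw_eq (i n : ℕ) (hi : 1 ≤ i) (hin : i ≤ n) : betaLaw i n =
    (volume.restrict (Set.Ioo (0:ℝ) 1)).withDensity fun t =>
      ENNReal.ofReal (bden (i-1) (n-i) t) := by
  have e1 : (i:ℝ) - 1 = ((i-1 : ℕ) : ℝ) := by push_cast [hi]; ring
  have e2 : (n:ℝ) - i = ((n-i : ℕ) : ℝ) := by push_cast [hin]; ring
  unfold betaLaw Bfun bden bint bker
  simp only [add_sub_cancel_right]
  rw [e1, e2]
  simp only [Real.rpow_natCast]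

lemma qset_bdd {F : ℝ → ℝ} (hF : IsCDF F) {p : ℝ} (hp : 0 < p) : BddBelow {x | p ≤ F x} := by
  obtain ⟨x, hx⟩ := (hF.2.2.1.eventually (gt_mem_nhds hp)).exists
  refine ⟨x, fun y hy => ?_⟩
  by_contra hlt
  have := hF.1 (not_le.mp hlt).le
  have hy' : p ≤ F y := hy
  linarith

lemma qset_ne {F : ℝ → ℝ} (hF : IsCDF F) {p : ℝ} (hp : p < 1) : {x | p ≤ F x}.Nonempty := by
  obtain ⟨x, hx⟩ := (hF.2.2.2.eventually (lt_mem_nhds hp)).exists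
  exact ⟨x, le_of_lt hx⟩

lemma qf_mono {F : ℝ → ℝ} (hF : IsCDF F) : MonotoneOn (qf F) (Ioo (0:ℝ) 1) := by
  intro p hp q hq hpq
  exact csInf_le_csInf (qset_bdd hF hp.1) (qset_ne hF hq.2) (fun x hx => le_trans hpq hx)

lemma exp_mem {y : ℝ} (hy : 0 < y) : 1 - Real.exp (-y) ∈ Ioo (0:ℝ) 1 := by
  have h1 := Real.exp_pos (-y)
  have h2 : Real.exp (-y) < 1 := Real.exp_lt_one_iff.mpr (by linarith)
  constructor <;> linarith

lemma qf_concave {F : ℝ → ℝ} (hF : IsCDF F)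
    (hIHR : ConvexOn ℝ {x : ℝ | F x < 1} (fun x => -Real.log (1 - F x))) :
    ConcaveOn ℝ (Ioi 0) (fun y => qf F (1 - Real.exp (-y))) := by
  refine ⟨convex_Ioi 0, ?_⟩
  intro y1 hy1 y2 hy2 l k hl hk hlk
  have hy : l • y1 + k • y2 ∈ Ioi (0:ℝ) := convex_Ioi 0 hy1 hy2 hl hk hlk
  simp only [smul_eq_mul] at *
  have below : ∀ y : ℝ, 0 < y → ∀ x, x < qf F (1 - Real.exp (-y)) →
      F x < 1 ∧ -Real.log (1 - F x) < y := by
    intro y hy x hx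
    have h1 : x ∉ {x | 1 - Real.exp (-y) ≤ F x} :=
      notMem_of_lt_csInf hx (qset_bdd hF (exp_mem hy).1)
    have h2 : F x < 1 - Real.exp (-y) := not_le.mp h1
    have h3 := Real.exp_pos (-y)
    refine ⟨by linarith, ?_⟩
    have : -y < Real.log (1 - F x) := (Real.lt_log_iff_exp_lt (by linarith)).mpr (by linarith)
    linarith
  by_contra hcon
  rw [not_le] at hcon
  set q1 := qf F (1 - Real.exp (-y1)) with hq1
  set q2 := qf F (1 - Real.exp (-y2)) with hq2
  set q := qf F (1 - Real.exp (-(l * y1 + k * y2))) with hq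
  obtain ⟨e, he, heq⟩ : ∃ e : ℝ, 0 < e ∧ q < l * (q1 - e) + k * (q2 - e) := by
    refine ⟨(l * q1 + k * q2 - q) / 2, by linarith, ?_⟩
    have : l * (q1 - (l * q1 + k * q2 - q) / 2) + k * (q2 - (l * q1 + k * q2 - q) / 2)
      = l * q1 + k * q2 - (l + k) * ((l * q1 + k * q2 - q) / 2) := by ring
    rw [this, hlk]; linarith
  obtain ⟨a1, b1⟩ := below y1 hy1 (q1 - e) (by linarith)
  obtain ⟨a2, b2⟩ := below y2 hy2 (q2 - e) (by linarith)
  have hz := hIHR.1 (x := q1 - e) a1 (y := q2 - e) a2 hl hk hlk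
  have hc := hIHR.2 (x := q1 - e) a1 (y := q2 - e) a2 hl hk hlk
  simp only [smul_eq_mul, mem_ofPred_eq] at hz hc
  obtain ⟨x, hxm, hxlt⟩ := exists_lt_of_csInf_lt (qset_ne hF (exp_mem hy).2) heq
  have hFz := hF.1 hxlt.le
  have hxm' : 1 - Real.exp (-(l * y1 + k * y2)) ≤ F x := hxm
  have hlog : Real.log (1 - F (l * (q1 - e) + k * (q2 - e))) ≤ -(l * y1 + k * y2) :=
    (Real.log_le_iff_le_exp (by linarith)).mpr (by linarith)
  have hlt : l * -Real.log (1 - F (q1 - e)) + k * -Real.log (1 - F (q2 - e))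
      < l * y1 + k * y2 := by
    rcases hl.lt_or_eq with h | h
    · nlinarith
    · have : k = 1 := by linarith
      subst this; rw [← h]; linarith
  linarith

lemma os_aem {F : ℝ → ℝ} (hF : IsCDF F) (i n : ℕ) : AEMeasurable (qf F) (betaLaw i n) :=
  (aemeasurable_restrict_of_monotoneOn measurableSet_Ioo (qf_mono hF)).mono_ac
    (withDensity_absolutelyContinuous _ _)

lemma os_integrable {F : ℝ → ℝ} (hF : IsCDF F) (i n : ℕ) (hi : 1 ≤ i) (hin : i ≤ n)
    (u : ℝ → ℝ) (hu : Monotone u) (h : Integrable u (osLaw F i n)) :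
    IntegrableOn (fun t => u (qf F t) * bden (i-1) (n-i) t) (Ioo (0:ℝ) 1) := by
  unfold osLaw at h
  rw [integrable_map_measure hu.measurable.aestronglyMeasurable (os_aem hF i n),
    betaLaw_eq i n hi hin, integrable_withDensity_iff_integrable_smul'] at h
  · apply h.congr
    filter_upwards [ae_restrict_mem measurableSet_Ioo] with t ht
    rw [ENNReal.toReal_ofReal (bden_pos _ _ ht).le]
    simp [mul_comm]
  · exact (((bker_cont _ _).div_const _).measurable).ennreal_ofReal
  · simp

lemma os_integral {F : ℝ → ℝ} (hF : IsCDF F) (i n : ℕ) (hi : 1 ≤ i) (hin : i ≤ n)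
    (u : ℝ → ℝ) (hu : Monotone u) :
    ∫ x, u x ∂(osLaw F i n) = ∫ t in Ioo (0:ℝ) 1, u (qf F t) * bden (i-1) (n-i) t := by
  unfold osLaw
  rw [integral_map (os_aem hF i n) hu.measurable.aestronglyMeasurable,
    betaLaw_eq i n hi hin, integral_withDensity_eq_integral_toReal_smul]
  · apply integral_congr_ae
    filter_upwards [ae_restrict_mem measurableSet_Ioo] with t ht
    rw [ENNReal.toReal_ofReal (bden_pos _ _ ht).le]
    simp [mul_comm]
  · exact (((bker_cont _ _).div_const _).measurable).ennreal_ofReal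
  · simp

lemma core_ineq (h f g : ℝ → ℝ) (L : ℝ → ℝ)
    (hf : IntegrableOn (fun t => h t * f t) (Ioo (0:ℝ) 1))
    (hg : IntegrableOn (fun t => h t * g t) (Ioo (0:ℝ) 1))
    (Lf : IntegrableOn (fun t => L t * f t) (Ioo (0:ℝ) 1))
    (Lg : IntegrableOn (fun t => L t * g t) (Ioo (0:ℝ) 1))
    (hL : ∫ t in Ioo (0:ℝ) 1, L t * g t ≤ ∫ t in Ioo (0:ℝ) 1, L t * f t)
    (hs : ∀ t ∈ Ioo (0:ℝ) 1, 0 ≤ (h t - L t) * (f t - g t)) :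
    ∫ t in Ioo (0:ℝ) 1, h t * g t ≤ ∫ t in Ioo (0:ℝ) 1, h t * f t := by
  have h0 : 0 ≤ ∫ t in Ioo (0:ℝ) 1, (h t - L t) * (f t - g t) :=
    setIntegral_nonneg measurableSet_Ioo hs
  have e : ∫ t in Ioo (0:ℝ) 1, (h t - L t) * (f t - g t) =
      (∫ t in Ioo (0:ℝ) 1, h t * f t) - (∫ t in Ioo (0:ℝ) 1, h t * g t)
      - ((∫ t in Ioo (0:ℝ) 1, L t * f t) - (∫ t in Ioo (0:ℝ) 1, L t * g t)) := by
    have e3 := integral_sub (hf.sub hg) (Lf.sub Lg)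
    simp only [Pi.sub_apply] at e3
    rw [← integral_sub hf hg, ← integral_sub Lf Lg, ← e3]
    congr 1
    ext t
    ring
  linarith

/-- If one density dominates the other pointwise, they agree a.e. -/
lemma dom_eq (h f g : ℝ → ℝ) (hf : IntegrableOn f (Ioo (0:ℝ) 1)) (hg : IntegrableOn g (Ioo (0:ℝ) 1))
    (he : ∫ t in Ioo (0:ℝ) 1, f t = ∫ t in Ioo (0:ℝ) 1, g t)
    (hle : ∀ t ∈ Ioo (0:ℝ) 1, f t ≤ g t) :
    ∫ t in Ioo (0:ℝ) 1, h t * g t = ∫ t in Ioo (0:ℝ) 1, h t * f t := by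
  have h0 : ∫ t in Ioo (0:ℝ) 1, (g t - f t) = 0 := by
    rw [integral_sub hg hf]; linarith
  rw [setIntegral_eq_zero_iff_of_nonneg_ae] at h0
  · apply integral_congr_ae
    filter_upwards [h0] with t ht
    have : g t = f t := by simpa [sub_eq_zero] using ht
    simp [this]
  · filter_upwards [ae_restrict_mem measurableSet_Ioo] with t ht
    simpa using hle t ht
  · exact hg.sub hf

lemma chord_sign {G : ℝ → ℝ} (hG : ConcaveOn ℝ (Ioi 0) G) {y1 y2 y : ℝ} (h1 : 0 < y1)
    (h12 : y1 < y2) (hy : 0 < y) :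
    ((y ≤ y1 ∨ y2 ≤ y) → G y ≤ G y1 + (G y2 - G y1) / (y2 - y1) * (y - y1)) ∧
    ((y1 ≤ y ∧ y ≤ y2) → G y1 + (G y2 - G y1) / (y2 - y1) * (y - y1) ≤ G y) := by
  have hd : 0 < y2 - y1 := by linarith
  have h2 : 0 < y2 := by linarith
  set s := (G y2 - G y1) / (y2 - y1) with hs
  have hs2 : G y2 = G y1 + s * (y2 - y1) := by rw [hs]; field_simp; ring
  constructor
  · rintro (h | h)
    · rcases h.lt_or_eq with h | h
      · have := hG.slope_anti_adjacent (x := y) (y := y1) (z := y2) hy h2 h h12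
        rw [← hs, le_div_iff₀ (by linarith)] at this
        linarith
      · subst h; simp
    · rcases h.lt_or_eq with h | h
      · have := hG.slope_anti_adjacent (x := y1) (y := y2) (z := y) h1 hy h12 h
        rw [← hs, div_le_iff₀ (by linarith)] at this
        linarith
      · subst h; linarith
  · rintro ⟨ha, hb⟩
    rcases ha.lt_or_eq with ha | ha
    · rcases hb.lt_or_eq with hb | hb
      · have := hG.slope_anti_adjacent (x := y1) (y := y) (z := y2) h1 h2 ha hb
        rw [div_le_div_iff₀ (by linarith) (by linarith), hs2] at this
        have h3 : 0 ≤ (G y - (G y1 + s * (y - y1))) * (y2 - y1) := by nlinarith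
        have := nonneg_of_mul_nonneg_left h3 hd
        linarith
      · subst hb; linarith
    · subst ha; simp

/-- log-likelihood ratio -/
lemma concave_ratio (a c K : ℝ) (ha : 0 ≤ a) (hc : 0 ≤ c) :
    ConcaveOn ℝ (Ioo (0:ℝ) 1) (fun p => a * Real.log p + c * Real.log (1 - p) + K) := by
  have h1 : ConcaveOn ℝ (Ioo (0:ℝ) 1) Real.log :=
    strictConcaveOn_log_Ioi.concaveOn.subset (fun x hx => hx.1) (convex_Ioo _ _)
  have h2 : ConcaveOn ℝ (Ioo (0:ℝ) 1) (fun p => Real.log (1 - p)) := by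
    refine ⟨convex_Ioo _ _, ?_⟩
    intro x hx y hy l k hl hk hlk
    have := strictConcaveOn_log_Ioi.concaveOn.2 (x := 1 - x) (by simpa using hx.2)
      (y := 1 - y) (by simpa using hy.2) hl hk hlk
    convert this using 2
    simp only [smul_eq_mul]; linear_combination -hlk
  exact ((h1.smul ha).add (h2.smul hc)).add_const K

lemma bden_log (a b : ℕ) {t : ℝ} (ht : t ∈ Ioo (0:ℝ) 1) :
    Real.log (bden a b t) = a * Real.log t + b * Real.log (1 - t) - Real.log (bint a b) := by
  have h1 := ht.1
  have h2 : 0 < 1 - t := by linarith [ht.2]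
  rw [bden, Real.log_div (bker_pos a b ht).ne' (bint_pos a b).ne', bker,
    Real.log_mul (by positivity) (by positivity), Real.log_pow, Real.log_pow]

lemma sum_lt_of (a b c : ℕ) (h : b < c) :
    ∑ k ∈ Finset.Icc (c + 1) (a + c + 1), (1:ℝ) / k
      < ∑ k ∈ Finset.Icc (b + 1) (a + b + 1), (1:ℝ) / k := by
  have e : ∀ d : ℕ, ∑ k ∈ Finset.Icc (d + 1) (a + d + 1), (1:ℝ) / k
      = ∑ k ∈ Finset.range (a + 1), (1:ℝ) / ((d:ℝ) + 1 + k) := by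
    intro d
    have : Finset.Icc (d + 1) (a + d + 1) = Finset.Ico (d + 1) (a + d + 2) := by
      ext x; simp only [Finset.mem_Ico, Finset.mem_Icc]; omega
    rw [this, Finset.sum_Ico_eq_sum_range, show a + d + 2 - (d + 1) = a + 1 by omega]
    push_cast
    rfl
  rw [e, e]
  have hbc : (b:ℝ) < c := by exact_mod_cast h
  apply Finset.sum_lt_sum_of_nonempty (by simp)
  intro k _
  apply one_div_lt_one_div_of_lt (by positivity)
  linarith

lemma psi_pos {t : ℝ} (ht : t ∈ Ioo (0:ℝ) 1) : 0 < -Real.log (1 - t) := by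
  have := Real.log_neg (x := 1 - t) (by linarith [ht.2]) (by linarith [ht.1])
  linarith

lemma psi_lt {s t : ℝ} (ht : t ∈ Ioo (0:ℝ) 1) (h : s < t) :
    -Real.log (1 - s) < -Real.log (1 - t) := by
  have := Real.log_lt_log (x := 1 - t) (y := 1 - s) (by linarith [ht.2]) (by linarith)
  linarith

lemma psi_le {s t : ℝ} (ht : t ∈ Ioo (0:ℝ) 1) (h : s ≤ t) :
    -Real.log (1 - s) ≤ -Real.log (1 - t) := by
  rcases h.lt_or_eq with h | h
  · exact (psi_lt ht h).le
  · rw [h]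

lemma beta_main (a1 b1 a2 b2 : ℕ) (ha : a2 ≤ a1)
    (hcond : ∑ k ∈ Finset.Icc (b2 + 1) (a2 + b2 + 1), (1:ℝ) / k ≤
      ∑ k ∈ Finset.Icc (b1 + 1) (a1 + b1 + 1), (1:ℝ) / k)
    (h G : ℝ → ℝ) (hG : ConcaveOn ℝ (Ioi 0) G) (hmono : MonotoneOn h (Ioo (0:ℝ) 1))
    (hGh : ∀ t ∈ Ioo (0:ℝ) 1, h t = G (-Real.log (1 - t)))
    (hf : IntegrableOn (fun t => h t * bden a1 b1 t) (Ioo (0:ℝ) 1))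
    (hg : IntegrableOn (fun t => h t * bden a2 b2 t) (Ioo (0:ℝ) 1)) :
    ∫ t in Ioo (0:ℝ) 1, h t * bden a2 b2 t ≤ ∫ t in Ioo (0:ℝ) 1, h t * bden a1 b1 t := by
  by_cases h1 : ∀ t ∈ Ioo (0:ℝ) 1, bden a1 b1 t ≤ bden a2 b2 t
  · exact (dom_eq h _ _ (bden_int _ _) (bden_int _ _) (by rw [bden_one, bden_one]) h1).le
  by_cases h2 : ∀ t ∈ Ioo (0:ℝ) 1, bden a2 b2 t ≤ bden a1 b1 t
  · exact (dom_eq h _ _ (bden_int _ _) (bden_int _ _) (by rw [bden_one, bden_one]) h2).ge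
  simp only [not_forall, not_le] at h1 h2
  obtain ⟨p, hp, hpw⟩ := h1
  obtain ⟨q, hq, hqw⟩ := h2
  set K := Real.log (bint a2 b2) - Real.log (bint a1 b1) with hK
  set w : ℝ → ℝ := fun t => ((a1:ℝ) - a2) * Real.log t + ((b1:ℝ) - b2) * Real.log (1 - t) + K
    with hw
  have hwlog : ∀ t ∈ Ioo (0:ℝ) 1, Real.log (bden a1 b1 t) - Real.log (bden a2 b2 t) = w t := by
    intro t ht
    rw [bden_log _ _ ht, bden_log _ _ ht, hw, hK]; ring
  have wneg : ∀ t ∈ Ioo (0:ℝ) 1, w t ≤ 0 → bden a1 b1 t ≤ bden a2 b2 t := by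
    intro t ht h0
    rw [← Real.log_le_log_iff (bden_pos _ _ ht) (bden_pos _ _ ht)]
    linarith [hwlog t ht]
  have wpos : ∀ t ∈ Ioo (0:ℝ) 1, 0 ≤ w t → bden a2 b2 t ≤ bden a1 b1 t := by
    intro t ht h0
    rw [← Real.log_le_log_iff (bden_pos _ _ ht) (bden_pos _ _ ht)]
    linarith [hwlog t ht]
  have hpw' : 0 < w p := by
    by_contra hc
    linarith [wneg p hp (not_lt.mp hc)]
  have hqw' : w q < 0 := by
    by_contra hc
    linarith [wpos q hq (not_lt.mp hc)]
  have hcont : ContinuousOn w (Ioo (0:ℝ) 1) := by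
    apply ContinuousOn.add _ continuousOn_const
    apply ContinuousOn.add
    · exact continuousOn_const.mul (Real.continuousOn_log.mono (fun x hx => by
        simpa using hx.1.ne'))
    · refine continuousOn_const.mul (ContinuousOn.log (by fun_prop) ?_)
      intro x hx
      linarith [hx.2]
  have haR : (a2:ℝ) ≤ a1 := by exact_mod_cast ha
  have hsub : ∀ x ∈ Ioo (0:ℝ) 1, ∀ y ∈ Ioo (0:ℝ) 1, Icc x y ⊆ Ioo (0:ℝ) 1 :=
    fun x hx y hy t ht => ⟨lt_of_lt_of_le hx.1 ht.1, lt_of_le_of_lt ht.2 hy.2⟩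
  rcases le_or_gt b1 b2 with hb | hb
  · have hbR : (b1:ℝ) ≤ b2 := by exact_mod_cast hb
    have wmono : MonotoneOn w (Ioo (0:ℝ) 1) := by
      intro s hs t ht hst
      have e1 : Real.log s ≤ Real.log t := Real.log_le_log hs.1 hst
      have e2 : Real.log (1 - t) ≤ Real.log (1 - s) :=
        Real.log_le_log (by linarith [ht.2]) (by linarith)
      simp only [hw]
      nlinarith [mul_le_mul_of_nonneg_left e1 (sub_nonneg.mpr haR),
        mul_le_mul_of_nonneg_left e2 (sub_nonneg.mpr hbR)]
    have hqp : q ≤ p := by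
      by_contra hc
      linarith [wmono hp hq (not_le.mp hc).le]
    obtain ⟨r, hr, hr0⟩ := intermediate_value_Icc hqp (hcont.mono (hsub q hq p hp))
      ⟨hqw'.le, hpw'.le⟩
    have hr' := hsub q hq p hp hr
    have Lf := bden_aff_int a1 b1 (h r) 0
    have Lg := bden_aff_int a2 b2 (h r) 0
    refine core_ineq h _ _ (fun t => h r + 0 * -Real.log (1 - t)) hf hg Lf Lg ?_ ?_
    · rw [bden_aff, bden_aff]; simp
    · intro t ht
      simp only [zero_mul, add_zero]
      rcases le_total t r with htr | htr
      · have e1 := hmono ht hr' htr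
        have e2 := wneg t ht ((wmono ht hr' htr).trans hr0.le)
        exact mul_nonneg_of_nonpos_of_nonpos (by linarith) (by linarith)
      · have e1 := hmono hr' ht htr
        have e2 := wpos t ht (hr0.ge.trans (wmono hr' ht htr))
        exact mul_nonneg (by linarith) (by linarith)
  · have hbR : (b2:ℝ) + 1 ≤ b1 := by exact_mod_cast hb
    rcases ha.lt_or_eq with ha' | ha'
    swap
    · subst ha'
      exact absurd hcond (not_le.mpr (sum_lt_of a2 b2 b1 hb))
    have haR' : (a2:ℝ) + 1 ≤ a1 := by exact_mod_cast ha'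
    have wconc : ConcaveOn ℝ (Ioo (0:ℝ) 1) w :=
      concave_ratio _ _ K (by linarith) (by linarith)
    have hpp := hp.1
    have hpp1 := hp.2
    have hlogneg : ∀ t ∈ Ioo (0:ℝ) 1, Real.log t ≤ 0 ∧ Real.log (1 - t) ≤ 0 := fun t ht =>
      ⟨Real.log_nonpos ht.1.le ht.2.le, Real.log_nonpos (by linarith [ht.2]) (by linarith [ht.1])⟩
    obtain ⟨r0, hr0, hr0p, hr0w⟩ : ∃ r ∈ Ioo (0:ℝ) 1, r ≤ p ∧ w r ≤ 0 := by
      have hpos : 0 < min (p/2) (Real.exp (-K)) := lt_min (by linarith) (Real.exp_pos _)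
      have hle : min (p/2) (Real.exp (-K)) ≤ p / 2 := min_le_left _ _
      have hmem : min (p/2) (Real.exp (-K)) ∈ Ioo (0:ℝ) 1 := ⟨hpos, by linarith⟩
      refine ⟨_, hmem, by linarith, ?_⟩
      have hl : Real.log (min (p/2) (Real.exp (-K))) ≤ -K :=
        (Real.log_le_iff_le_exp hpos).mpr (min_le_right _ _)
      obtain ⟨e1, e2⟩ := hlogneg _ hmem
      simp only [hw]
      nlinarith
    obtain ⟨r3, hr3, hr3p, hr3w⟩ : ∃ r ∈ Ioo (0:ℝ) 1, p ≤ r ∧ w r ≤ 0 := by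
      have hpos : 0 < min ((1-p)/2) (Real.exp (-K)) := lt_min (by linarith) (Real.exp_pos _)
      have hle : min ((1-p)/2) (Real.exp (-K)) ≤ (1-p) / 2 := min_le_left _ _
      have hmem : 1 - min ((1-p)/2) (Real.exp (-K)) ∈ Ioo (0:ℝ) 1 :=
        ⟨by linarith, by linarith⟩
      refine ⟨_, hmem, by linarith, ?_⟩
      have hl : Real.log (min ((1-p)/2) (Real.exp (-K))) ≤ -K :=
        (Real.log_le_iff_le_exp hpos).mpr (min_le_right _ _)
      obtain ⟨e1, e2⟩ := hlogneg _ hmem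
      simp only [hw]
      rw [sub_sub_cancel] at e2 ⊢
      nlinarith
    obtain ⟨r1, hr1, hr1w⟩ := intermediate_value_Icc hr0p (hcont.mono (hsub r0 hr0 p hp))
      ⟨hr0w, hpw'.le⟩
    obtain ⟨r2, hr2, hr2w⟩ := intermediate_value_Icc' hr3p (hcont.mono (hsub p hp r3 hr3))
      ⟨hr3w, hpw'.le⟩
    have hr1' := hsub r0 hr0 p hp hr1
    have hr2' := hsub p hp r3 hr3 hr2
    have hr1p : r1 ≤ p := hr1.2
    have hr2p : p ≤ r2 := hr2.1
    have hr12 : r1 < r2 := by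
      rcases hr1p.lt_or_eq with h3 | h3
      · linarith
      · rw [h3] at hr1w; linarith
    have hY := psi_lt hr2' hr12
    have hY1 := psi_pos hr1'
    set Y1 := -Real.log (1 - r1) with hY1d
    set Y2 := -Real.log (1 - r2) with hY2d
    set s := (G Y2 - G Y1) / (Y2 - Y1) with hs
    have hs0 : 0 ≤ s := by
      have := hmono hr1' hr2' hr12.le
      rw [hGh _ hr1', hGh _ hr2'] at this
      exact div_nonneg (by linarith) (by linarith)
    have Lf := bden_aff_int a1 b1 (G Y1 - s * Y1) s
    have Lg := bden_aff_int a2 b2 (G Y1 - s * Y1) s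
    refine core_ineq h _ _ (fun t => (G Y1 - s * Y1) + s * -Real.log (1 - t)) hf hg Lf Lg ?_ ?_
    · rw [bden_aff, bden_aff]
      nlinarith [mul_le_mul_of_nonneg_left hcond hs0]
    · intro t ht
      have hch := chord_sign hG hY1 hY (psi_pos ht)
      rw [← hs] at hch
      rw [hGh t ht]
      set y := -Real.log (1 - t) with hy
      rcases le_total t r1 with c1 | c1
      · have e1 := hch.1 (Or.inl (psi_le hr1' c1))
        have e2 : w t ≤ 0 := by
          by_contra hc
          have := wconc.min_le_of_mem_Icc ht hp ⟨c1, hr1p⟩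
          have h4 : 0 < min (w t) (w p) := lt_min (not_le.mp hc) hpw'
          linarith
        exact mul_nonneg_of_nonpos_of_nonpos (by linarith) (by linarith [wneg t ht e2])
      · rcases le_total r2 t with c2 | c2
        · have e1 := hch.1 (Or.inr (psi_le ht c2))
          have e2 : w t ≤ 0 := by
            by_contra hc
            have := wconc.min_le_of_mem_Icc hp ht ⟨hr2p, c2⟩
            have h4 : 0 < min (w p) (w t) := lt_min hpw' (not_le.mp hc)
            linarith
          exact mul_nonneg_of_nonpos_of_nonpos (by linarith) (by linarith [wneg t ht e2])
        · have e1 := hch.2 ⟨psi_le ht c1, psi_le hr2' c2⟩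
          have e2 : 0 ≤ w t := by
            have := wconc.min_le_of_mem_Icc hr1' hr2' ⟨c1, c2⟩
            rw [hr1w, hr2w, min_self] at this
            exact this
          exact mul_nonneg (by linarith) (by linarith [wpos t ht e2])

/-- If `F` is IHR (`-log(1-F)` convex on `{F < 1}`) and
`∑_{k=n-i+1}^n 1/k ≥ ∑_{k=m-j+1}^m 1/k` with `i ≥ j`, then `X_{i:n} ≥_icv X_{j:m}`. -/
theorem stmt2 (F : ℝ → ℝ) (hF : IsCDF F)
    (i n j m : ℕ) (hj1 : 1 ≤ j) (hjm : j ≤ m) (hi1 : 1 ≤ i) (hin : i ≤ n) (hij : j ≤ i)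
    (hIHR : ConvexOn ℝ {x : ℝ | F x < 1} (fun x => -Real.log (1 - F x)))
    (hcond : ∑ k ∈ Finset.Icc (m - j + 1) m, (1:ℝ) / k ≤
      ∑ k ∈ Finset.Icc (n - i + 1) n, (1:ℝ) / k) :
    icvLE (osLaw F i n) (osLaw F j m) := by
  intro u hu huc hint1 hint2
  rw [os_integral hF i n hi1 hin u hu, os_integral hF j m hj1 hjm u hu]
  refine beta_main (i-1) (n-i) (j-1) (m-j) (by omega) ?_ (fun t => u (qf F t))
    (fun y => u (qf F (1 - Real.exp (-y)))) ?_ ?_ ?_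
    (os_integrable hF i n hi1 hin u hu hint1) (os_integrable hF j m hj1 hjm u hu hint2)
  · rw [show j - 1 + (m - j) + 1 = m by omega, show i - 1 + (n - i) + 1 = n by omega]
    exact hcond
  · have hq := qf_concave hF hIHR
    refine ⟨hq.1, ?_⟩
    intro x hx y hy l k hl hk hlk
    exact (huc.2 (mem_univ _) (mem_univ _) hl hk hlk).trans (hu (hq.2 hx hy hl hk hlk))
  · intro s hs t ht hst
    exact hu (qf_mono hF hs ht hst)
  · intro t ht
    simp only [neg_neg]
    rw [Real.exp_log (by linarith [ht.2]), sub_sub_cancel]
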